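/- For all integers k ≥ 0 and n ≥ r ≥ 1, Σ_{j=r}^{n} (−1)^{n−j} · S_r(n,j) · ĉ_{j,k} = Σ_{ℓ=1}^{r} c(r,ℓ) · (n−r+ℓ+1)^k. -/

import Mathlib

/-- Unsigned Stirling numbers of the first kind:
`c(0,0)=1`, `c(n,m)=0` for `m>n` or (`n>0` and `m=0`), and `c(n+1,m)=n*c(n,m)+c(n,m-1)`. -/
def stirling1 : ℕ → ℕ → ℕ
  | 0, 0 => 1
  | 0, _ + 1 => 0
  | _ + 1, 0 => 0
  | n + 1, m + 1 => n * stirling1 n (m + 1) + stirling1 n m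

/-- Stirling numbers of the second kind:
`S(0,0)=1`, `S(n,m)=0` for `m>n` or (`n>0` and `m=0`), and `S(n+1,m)=m*S(n,m)+S(n,m-1)`. -/
def stirling2 : ℕ → ℕ → ℕ
  | 0, 0 => 1
  | 0, _ + 1 => 0
  | _ + 1, 0 => 0
  | n + 1, m + 1 => (m + 1) * stirling2 n (m + 1) + stirling2 n m

/-- Poly-Cauchy numbers of the second kind (negated upper index, unsigned):
`ĉ_{n,k} = Σ_{m=0}^n c(n,m)·(m+1)^k`. -/
def polyCauchy (n k : ℕ) : ℕ := ∑ m ∈ Finset.range (n + 1), stirling1 n m * (m + 1) ^ k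

/-- `rStirling2 r d j` is the `r`-Stirling number of the second kind `S_r(r+d, j)`:
`S_r(r,j) = 1` if `j = r` and `0` otherwise, and
`S_r(n+1,j) = j·S_r(n,j) + S_r(n,j-1)` for `n ≥ r`. -/
def rStirling2 (r : ℕ) : ℕ → ℕ → ℕ
  | 0, j => if j = r then 1 else 0
  | _ + 1, 0 => 0
  | d + 1, j + 1 => (j + 1) * rStirling2 r d (j + 1) + rStirling2 r d j

theorem stirling1_eq_zero_of_lt : ∀ {n m : ℕ}, n < m → stirling1 n m = 0
  | 0, _ + 1, _ => rfl
  | n + 1, m + 1, h => by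
    simp [stirling1, stirling1_eq_zero_of_lt (show n < m + 1 by lia),
      stirling1_eq_zero_of_lt (show n < m by lia)]

theorem rStirling2_eq_zero_of_lt {r : ℕ} : ∀ {d j : ℕ}, j < r → rStirling2 r d j = 0
  | 0, _, h => if_neg h.ne
  | _ + 1, 0, _ => rfl
  | d + 1, j + 1, h => by
    simp [rStirling2, rStirling2_eq_zero_of_lt (d := d) h,
      rStirling2_eq_zero_of_lt (d := d) (show j < r by lia)]

theorem rStirling2_eq_zero_of_add_lt {r : ℕ} :
    ∀ {d j : ℕ}, r + d < j → rStirling2 r d j = 0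
  | 0, _, h => if_neg (by lia)
  | d + 1, j + 1, h => by
    simp [rStirling2, rStirling2_eq_zero_of_add_lt (show r + d < j + 1 by lia),
      rStirling2_eq_zero_of_add_lt (show r + d < j by lia)]

/-- The first-kind Stirling transform of `f`. -/
def stirling1Transform (f : ℕ → ℤ) (n : ℕ) : ℤ :=
  ∑ m ∈ Finset.range (n + 1), (stirling1 n m : ℤ) * f m

theorem stirling1Transform_succ (f : ℕ → ℤ) (n : ℕ) :
    stirling1Transform f (n + 1)
      = n * stirling1Transform f n + stirling1Transform (fun m => f (m + 1)) n := by
  have h : (n : ℤ) * stirling1Transform f n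
      = ∑ m ∈ Finset.range (n + 1), (n : ℤ) * (stirling1 n (m + 1) * f (m + 1)) := by
    rw [stirling1Transform, Finset.sum_range_succ', Finset.sum_range_succ, mul_add,
      Finset.mul_sum, stirling1_eq_zero_of_lt (Nat.lt_succ_self n)]
    cases n <;> simp [stirling1]
  rw [h, stirling1Transform, stirling1Transform, Finset.sum_range_succ',
    ← Finset.sum_add_distrib]
  simp only [stirling1, Nat.cast_zero, zero_mul, add_zero]
  refine Finset.sum_congr rfl fun m _ => ?_
  push_cast
  ring

/-- Pairing `S_r(r+d, ·)` with a first-kind Stirling transform shifts its argument by `d`. -/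
theorem sum_rStirling2_mul_stirling1Transform (r d : ℕ) (f : ℕ → ℤ) :
    ∑ j ∈ Finset.range (r + d + 1),
        (-1 : ℤ) ^ (r + d + j) * rStirling2 r d j * stirling1Transform f j
      = stirling1Transform (fun m => f (m + d)) r := by
  induction d generalizing f with
  | zero =>
    rw [Finset.sum_eq_single_of_mem r (by simp) (fun j _ hj => by simp [rStirling2, hj])]
    simp [rStirling2, ← two_mul]
  | succ d ih =>
    have shift : ∑ j ∈ Finset.range (r + d + 1),
          (-1 : ℤ) ^ (r + d + j) * j * rStirling2 r d j * stirling1Transform f j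
        = ∑ j ∈ Finset.range (r + d + 1), (-1 : ℤ) ^ (r + d + (j + 1)) * (j + 1 : ℕ) *
            rStirling2 r d (j + 1) * stirling1Transform f (j + 1) := by
      rw [Finset.sum_range_succ', Finset.sum_range_succ _ (r + d),
        rStirling2_eq_zero_of_add_lt (Nat.lt_succ_self (r + d))]
      simp
    have h := ih fun m => f (m + 1)
    simp only [add_assoc] at h
    simp only [add_assoc] at shift ⊢
    rw [← h, ← add_assoc d 1 1, ← add_assoc r, Finset.sum_range_succ']
    simp only [rStirling2, Nat.cast_zero, mul_zero, zero_mul, add_zero]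
    refine eq_of_sub_eq_zero (Eq.trans ?_ (sub_eq_zero.mpr shift))
    rw [← Finset.sum_sub_distrib, ← Finset.sum_sub_distrib]
    refine Finset.sum_congr rfl fun j _ => ?_
    rw [stirling1Transform_succ]
    push_cast
    ring

theorem polyCauchy_eq_stirling1Transform (n k : ℕ) :
    (polyCauchy n k : ℤ) = stirling1Transform (fun m => ((m + 1 : ℕ) : ℤ) ^ k) n := by
  simp [polyCauchy, stirling1Transform]

theorem rStirling2_polyCauchy (n k r : ℕ) (hr : 1 ≤ r) (hrn : r ≤ n) :
    ∑ j ∈ Finset.Icc r n, (-1 : ℤ) ^ (n - j) * rStirling2 r (n - r) j * polyCauchy j k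
      = ∑ ℓ ∈ Finset.Icc 1 r, (stirling1 r ℓ : ℤ) * ((n - r + ℓ + 1 : ℕ) : ℤ) ^ k := by
  obtain ⟨d, rfl⟩ := Nat.exists_eq_add_of_le hrn
  rw [Nat.add_sub_cancel_left]
  trans ∑ j ∈ Finset.range (r + d + 1), (-1 : ℤ) ^ (r + d + j) * rStirling2 r d j *
      stirling1Transform (fun m => ((m + 1 : ℕ) : ℤ) ^ k) j
  · refine Finset.sum_subset_zero_on_sdiff (fun j hj => ?_) (fun j hj => ?_) (fun j hj => ?_)
    · simp only [Finset.mem_Icc, Finset.mem_range] at *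
      lia
    · simp only [Finset.mem_sdiff, Finset.mem_Icc, Finset.mem_range] at hj
      rw [rStirling2_eq_zero_of_lt (by lia)]
      simp
    · obtain ⟨e, he⟩ := Nat.exists_eq_add_of_le (Finset.mem_Icc.mp hj).2
      have hsign : (-1 : ℤ) ^ (r + d - j) = (-1) ^ (r + d + j) := by
        rw [he, Nat.add_sub_cancel_left, show j + e + j = 2 * j + e by ring, pow_add, pow_mul]
        simp
      rw [hsign, polyCauchy_eq_stirling1Transform]
  · rw [sum_rStirling2_mul_stirling1Transform, stirling1Transform]
    symm
    refine Finset.sum_subset_zero_on_sdiff (fun j hj => ?_) (fun j hj => ?_) (fun j hj => ?_)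
    · simp only [Finset.mem_Icc, Finset.mem_range] at *
      lia
    · simp only [Finset.mem_sdiff, Finset.mem_Icc, Finset.mem_range] at hj
      obtain rfl : j = 0 := by lia
      obtain ⟨s, rfl⟩ := Nat.exists_eq_succ_of_ne_zero (show r ≠ 0 by lia)
      simp [stirling1]
    · rw [add_comm d j]
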